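/- Let ε ∈ ℝ and let R¹, R² : ℝ³ → ℝ be smooth functions of (x,y,t) with R¹(p) ≠ R²(p) at every point p, satisfying: R¹_t = (3R¹+R²)·R¹_x + ε²/(R¹−R²)·(R¹_xxx + R²_xxx); R²_t = (R¹+3R²)·R²_x − ε²/(R¹−R²)·(R¹_xxx + R²_xxx); R¹_y = (3/2)·(5(R¹)² + 2R¹R² + (R²)²)·R¹_x + ε²/(R¹−R²)·((5R¹+R²)·R¹_xxx + 3R¹_x·(3R¹_xx + R²_xx) + 3R²_x·(R¹_xx + 3R²_xx) + 3(R¹+R²)·R²_xxx); R²_y = (3/2)·((R¹)² + 2R¹R² + 5(R²)²)·R²_x − ε²/(R¹−R²)·(3(R¹+R²)·R¹_xxx + 3R¹_x·(3R¹_xx + R²_xx) + 3R²_x·(R¹_xx + 3R²_xx) + (R¹+5R²)·R²_xxx). Then u = R¹ + R² and w = (1/2)·(R¹+R²)² + (R¹)² + (R²)² form a solution of the Mikhalev system. -/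

import Mathlib

/-- Partial derivative with respect to the first variable `x`. -/
noncomputable def pdx (u : ℝ → ℝ → ℝ → ℝ) (x y t : ℝ) : ℝ := deriv (fun s => u s y t) x

/-- Partial derivative with respect to the second variable `y`. -/
noncomputable def pdy (u : ℝ → ℝ → ℝ → ℝ) (x y t : ℝ) : ℝ := deriv (fun s => u x s t) y

/-- Partial derivative with respect to the third variable `t`. -/
noncomputable def pdt (u : ℝ → ℝ → ℝ → ℝ) (x y t : ℝ) : ℝ := deriv (fun s => u x y s) t

/-- Smoothness of a function of three real variables. -/
def Smooth3 (u : ℝ → ℝ → ℝ → ℝ) : Prop :=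
  ContDiff ℝ (⊤ : ℕ∞) (fun p : ℝ × ℝ × ℝ => u p.1 p.2.1 p.2.2)

/-- The Mikhalev system: `u_t = w_x` and `u_y = w_t - u w_x + w u_x`. -/
def Mikhalev (u w : ℝ → ℝ → ℝ → ℝ) : Prop :=
  ∀ x y t : ℝ,
    pdt u x y t = pdx w x y t ∧
    pdy u x y t = pdt w x y t - u x y t * pdx w x y t + w x y t * pdx u x y t

/-- A smooth function of three variables is differentiable in `x`, with derivative `pdx`. -/
theorem Smooth3.hasDerivAt_pdx {u : ℝ → ℝ → ℝ → ℝ} (hu : Smooth3 u) (x y t : ℝ) :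
    HasDerivAt (fun s => u s y t) (pdx u x y t) x := by
  have h : Differentiable ℝ (fun p : ℝ × ℝ × ℝ => u p.1 p.2.1 p.2.2) :=
    ContDiff.differentiable hu (by simp)
  exact (h.comp (f := fun s : ℝ => (s, y, t)) (by fun_prop) x).hasDerivAt

/-- A smooth function of three variables is differentiable in `y`, with derivative `pdy`. -/
theorem Smooth3.hasDerivAt_pdy {u : ℝ → ℝ → ℝ → ℝ} (hu : Smooth3 u) (x y t : ℝ) :
    HasDerivAt (fun s => u x s t) (pdy u x y t) y := by
  have h : Differentiable ℝ (fun p : ℝ × ℝ × ℝ => u p.1 p.2.1 p.2.2) :=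
    ContDiff.differentiable hu (by simp)
  exact (h.comp (f := fun s : ℝ => (x, s, t)) (by fun_prop) y).hasDerivAt

/-- A smooth function of three variables is differentiable in `t`, with derivative `pdt`. -/
theorem Smooth3.hasDerivAt_pdt {u : ℝ → ℝ → ℝ → ℝ} (hu : Smooth3 u) (x y t : ℝ) :
    HasDerivAt (fun s => u x y s) (pdt u x y t) t := by
  have h : Differentiable ℝ (fun p : ℝ × ℝ × ℝ => u p.1 p.2.1 p.2.2) :=
    ContDiff.differentiable hu (by simp)
  exact (h.comp (f := fun s : ℝ => (x, y, s)) (by fun_prop) t).hasDerivAt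

/-- The derivative of `(f + g)² / 2 + f² + g²`. -/
theorem HasDerivAt.half_sq_add_add_sq_add_sq {f g : ℝ → ℝ} {f' g' s : ℝ}
    (hf : HasDerivAt f f' s) (hg : HasDerivAt g g' s) :
    HasDerivAt (fun r => (1 / 2) * (f r + g r) ^ 2 + (f r) ^ 2 + (g r) ^ 2)
      ((3 * f s + g s) * f' + (f s + 3 * g s) * g') s := by
  refine (((((hf.fun_add hg).fun_pow 2).const_mul (1 / 2)).fun_add (hf.fun_pow 2)).fun_add
    (hg.fun_pow 2)).congr_deriv ?_
  push_cast
  ring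

theorem stmt_15 (ε : ℝ) (R1 R2 : ℝ → ℝ → ℝ → ℝ)
    (hR1 : Smooth3 R1) (hR2 : Smooth3 R2)
    (hne : ∀ x y t : ℝ, R1 x y t ≠ R2 x y t)
    (ht1 : ∀ x y t : ℝ, pdt R1 x y t =
      (3 * R1 x y t + R2 x y t) * pdx R1 x y t
        + ε ^ 2 / (R1 x y t - R2 x y t)
          * (pdx (pdx (pdx R1)) x y t + pdx (pdx (pdx R2)) x y t))
    (ht2 : ∀ x y t : ℝ, pdt R2 x y t =
      (R1 x y t + 3 * R2 x y t) * pdx R2 x y t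
        - ε ^ 2 / (R1 x y t - R2 x y t)
          * (pdx (pdx (pdx R1)) x y t + pdx (pdx (pdx R2)) x y t))
    (hy1 : ∀ x y t : ℝ, pdy R1 x y t =
      (3 / 2) * (5 * (R1 x y t) ^ 2 + 2 * R1 x y t * R2 x y t + (R2 x y t) ^ 2)
          * pdx R1 x y t
        + ε ^ 2 / (R1 x y t - R2 x y t) *
          ((5 * R1 x y t + R2 x y t) * pdx (pdx (pdx R1)) x y t
            + 3 * pdx R1 x y t * (3 * pdx (pdx R1) x y t + pdx (pdx R2) x y t)
            + 3 * pdx R2 x y t * (pdx (pdx R1) x y t + 3 * pdx (pdx R2) x y t)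
            + 3 * (R1 x y t + R2 x y t) * pdx (pdx (pdx R2)) x y t))
    (hy2 : ∀ x y t : ℝ, pdy R2 x y t =
      (3 / 2) * ((R1 x y t) ^ 2 + 2 * R1 x y t * R2 x y t + 5 * (R2 x y t) ^ 2)
          * pdx R2 x y t
        - ε ^ 2 / (R1 x y t - R2 x y t) *
          (3 * (R1 x y t + R2 x y t) * pdx (pdx (pdx R1)) x y t
            + 3 * pdx R1 x y t * (3 * pdx (pdx R1) x y t + pdx (pdx R2) x y t)
            + 3 * pdx R2 x y t * (pdx (pdx R1) x y t + 3 * pdx (pdx R2) x y t)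
            + (R1 x y t + 5 * R2 x y t) * pdx (pdx (pdx R2)) x y t)) :
    Mikhalev (fun x y t => R1 x y t + R2 x y t)
      (fun x y t => (1 / 2) * (R1 x y t + R2 x y t) ^ 2
        + (R1 x y t) ^ 2 + (R2 x y t) ^ 2) := by
  intro x y t
  have ux := ((hR1.hasDerivAt_pdx x y t).fun_add (hR2.hasDerivAt_pdx x y t)).deriv
  have uy := ((hR1.hasDerivAt_pdy x y t).fun_add (hR2.hasDerivAt_pdy x y t)).deriv
  have ut := ((hR1.hasDerivAt_pdt x y t).fun_add (hR2.hasDerivAt_pdt x y t)).deriv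
  have wx := ((hR1.hasDerivAt_pdx x y t).half_sq_add_add_sq_add_sq
    (hR2.hasDerivAt_pdx x y t)).deriv
  have wt := ((hR1.hasDerivAt_pdt x y t).half_sq_add_add_sq_add_sq
    (hR2.hasDerivAt_pdt x y t)).deriv
  have hD : R1 x y t - R2 x y t ≠ 0 := sub_ne_zero.mpr (hne x y t)
  constructor
  · refine ut.trans (Eq.trans ?_ wx.symm)
    rw [ht1, ht2]
    ring
  · refine uy.trans ?_
    change _ = deriv _ _ - _ * deriv _ _ + _ * deriv _ _
    rw [wt, wx, ux, hy1, hy2, ht1, ht2]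
    field_simp
    ring
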